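/- Let T⃗ = (T_1,…,T_d) be a vector homogeneous tree, W a homogeneous tree with branching number b_W, 0 < ε ≤ 1 and D : ⊗T⃗ → 2^W an ε-dense level selection. Set Θ_n = |fan(T⃗,n)| and θ_n = ε/(2 b_W Θ_n) for n ≥ 1. Assume hypothesis (H): for every vector strong subtree R⃗ of T⃗, every w ∈ W and every 0 < θ ≤ 1, the pair (R⃗, w) is not strongly θ-correlated with respect to D. Then for every vector strong subtree R⃗ of T⃗ with root tuple r⃗_0 there exist a vector strong subtree S⃗ of R⃗ with root tuple r⃗_0 and a map φ : D(r⃗_0) → {0,…,b_W−1} such that for every n ≥ 1, every vector fan F⃗ ∈ fan(S⃗,n) with F⃗(0) = r⃗_0 and every w ∈ D(r⃗_0), dens(⋂_{s⃗ ∈ ⊗F⃗(1)} D(s⃗) | w⌢_W φ(w)) ≤ θ_n. -/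

import Mathlib

open Filter

namespace DHLPaper

/-- The tree `b^{<ℕ}` of all finite sequences with values in `{0,…,b−1}`,
partially ordered by end-extension (`List.IsPrefix`, written `<+:`). -/
def bSeq (b : ℕ) : Set (List ℕ) := {t | ∀ x ∈ t, x < b}

/-- The set of successors of `t` in `T`: `Suc_T(t) = {s ∈ T : t ≤ s}`. -/
def suc (T : Set (List ℕ)) (t : List ℕ) : Set (List ℕ) := {s ∈ T | t <+: s}

/-- `s` is an immediate successor of `t` in `T`. -/
def ImmSuc (T : Set (List ℕ)) (t s : List ℕ) : Prop :=
  t ∈ T ∧ s ∈ T ∧ t <+: s ∧ t ≠ s ∧ ∀ u ∈ T, t <+: u → u <+: s → u = t ∨ u = s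

/-- The `n`-th level of `T`: the nodes of `T` with exactly `n` strict predecessors in `T`. -/
def level (T : Set (List ℕ)) (n : ℕ) : Set (List ℕ) :=
  {t ∈ T | {s ∈ T | s <+: t ∧ s ≠ t}.ncard = n}

/-- `T` has exactly one minimal node. -/
def UniquelyRooted (T : Set (List ℕ)) : Prop := ∃! r, r ∈ level T 0

/-- Every node of `T` has finitely many immediate successors in `T`. -/
def FinitelyBranching (T : Set (List ℕ)) : Prop := ∀ t ∈ T, {s | ImmSuc T t s}.Finite

/-- Every node of `T` has at least one immediate successor in `T`. -/
def Pruned (T : Set (List ℕ)) : Prop := ∀ t ∈ T, ∃ s, ImmSuc T t s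

/-- `S` is a strong subtree of `T` whose level set `L_T(S)` is enumerated by the strictly
increasing map `l`: `S(n) ⊆ T(l n)` for every `n`, `S` is uniquely rooted, and for every
`s ∈ S` and every immediate successor `t` of `s` in `T` there is a unique immediate
successor `s'` of `s` in `S` with `t ≤ s'`. -/
def IsStrongSubtreeWith (T S : Set (List ℕ)) (l : ℕ → ℕ) : Prop :=
  S ⊆ T ∧ UniquelyRooted S ∧ StrictMono l ∧
    (∀ n, level S n ⊆ level T (l n)) ∧
    (∀ s ∈ S, ∀ t, ImmSuc T s t → ∃! s', ImmSuc S s s' ∧ t <+: s')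

/-- `S` is a strong subtree of `T`. -/
def IsStrongSubtree (T S : Set (List ℕ)) : Prop := ∃ l, IsStrongSubtreeWith T S l

/-- A homogeneous tree with branching number `b`: a strong subtree of `b^{<ℕ}`, `b ≥ 2`. -/
def IsHomogeneous (b : ℕ) (T : Set (List ℕ)) : Prop := 2 ≤ b ∧ IsStrongSubtree (bSeq b) T

/-- A vector homogeneous tree: a `d`-tuple of homogeneous trees. -/
def IsVecHomogeneous {d : ℕ} (b : Fin d → ℕ) (T : Fin d → Set (List ℕ)) : Prop :=
  ∀ i, IsHomogeneous (b i) (T i)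

/-- Vector strong subtree: componentwise strong subtrees with a common level set. -/
def IsVecStrongSubtree {d : ℕ} (T S : Fin d → Set (List ℕ)) : Prop :=
  ∃ l, ∀ i, IsStrongSubtreeWith (T i) (S i) l

/-- `⊗T(n) = T_1(n) × ⋯ × T_d(n)`. -/
def vecLevel {d : ℕ} (T : Fin d → Set (List ℕ)) (n : ℕ) : Set (Fin d → List ℕ) :=
  {v | ∀ i, v i ∈ level (T i) n}

/-- The level product `⊗T = ⋃_n ⊗T(n)`. -/
def levelProd {d : ℕ} (T : Fin d → Set (List ℕ)) : Set (Fin d → List ℕ) :=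
  ⋃ n, vecLevel T n

/-- `r` is the root tuple of the vector tree `T`. -/
def IsRoot {d : ℕ} (T : Fin d → Set (List ℕ)) (r : Fin d → List ℕ) : Prop :=
  ∀ i, level (T i) 0 = {r i}

/-- `F` is a vector fan of `T`: `F = (R_1(0) ∪ R_1(1), …, R_d(0) ∪ R_d(1))` for some
vector strong subtree `R` of `T`. -/
def IsVecFan {d : ℕ} (T F : Fin d → Set (List ℕ)) : Prop :=
  ∃ R : Fin d → Set (List ℕ), IsVecStrongSubtree T R ∧
    ∀ i, F i = level (R i) 0 ∪ level (R i) 1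

/-- `fan(T,n)`: the vector fans of `T` with `⊗F(1) ⊆ ⊗T(n)`. -/
def fanAt {d : ℕ} (T : Fin d → Set (List ℕ)) (n : ℕ) : Set (Fin d → Set (List ℕ)) :=
  {F | IsVecFan T F ∧ vecLevel F 1 ⊆ vecLevel T n}

/-- Density of `F ⊆ W(n)` in the `n`-th level of `W`. -/
noncomputable def dens (W : Set (List ℕ)) (n : ℕ) (F : Set (List ℕ)) : ℝ :=
  (F.ncard : ℝ) / ((level W n).ncard : ℝ)

/-- Density of `F ⊆ W(n)` relative to the node `w`. -/
noncomputable def densRel (W : Set (List ℕ)) (n : ℕ) (F : Set (List ℕ)) (w : List ℕ) : ℝ :=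
  ((F ∩ suc W w).ncard : ℝ) / ((level W n ∩ suc W w).ncard : ℝ)

/-- `s = w ⌢_W p`: `s` is the immediate successor of `w` in `W` such that the
concatenation `w ⌢ p` is an initial segment of `s`. -/
def IsConcat (W : Set (List ℕ)) (w : List ℕ) (p : ℕ) (s : List ℕ) : Prop :=
  ImmSuc W w s ∧ w ++ [p] <+: s

/-- The density Halpern–Läuchli statement in dimension `d`. -/
def DHL (d : ℕ) : Prop :=
  ∀ (b : Fin d → ℕ) (T : Fin d → Set (List ℕ)), IsVecHomogeneous b T →
    ∀ D : Set (Fin d → List ℕ), D ⊆ levelProd T →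
      0 < Filter.limsup
          (fun n => ((D ∩ vecLevel T n).ncard : ℝ) / ((vecLevel T n).ncard : ℝ)) atTop →
      ∃ S : Fin d → Set (List ℕ), IsVecStrongSubtree T S ∧ levelProd S ⊆ D

/-- `D : ⊗T → 2^W` is an `ε`-dense level selection along the strictly increasing
sequence `l`: for every `n` and every `t⃗ ∈ ⊗T(n)`, `D(t⃗) ⊆ W(l n)` and
`dens(D(t⃗)) ≥ ε`. -/
def IsDenseLevelSel {d : ℕ} (T : Fin d → Set (List ℕ)) (W : Set (List ℕ)) (l : ℕ → ℕ)
    (ε : ℝ) (D : (Fin d → List ℕ) → Set (List ℕ)) : Prop :=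
  StrictMono l ∧ ∀ n, ∀ v ∈ vecLevel T n, D v ⊆ level W (l n) ∧ ε ≤ dens W (l n) (D v)

/-- The pair `(R, w)` (`R` a vector strong subtree of `T` with root tuple `r0`) is strongly
`θ`-correlated with respect to the dense level selection `D` (with level sequence `l`):
`w ∈ D(r0)` and for every vector fan `F` of `R` with `F(0) = r0` and every `p < b_W`,
`dens(⋂_{r ∈ ⊗F(1)} D(r) | w ⌢_W p) ≥ θ`. -/
def StronglyCorrelated {d : ℕ} (T : Fin d → Set (List ℕ)) (W : Set (List ℕ)) (bW : ℕ)
    (l : ℕ → ℕ) (D : (Fin d → List ℕ) → Set (List ℕ)) (R : Fin d → Set (List ℕ))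
    (r0 : Fin d → List ℕ) (w : List ℕ) (θ : ℝ) : Prop :=
  w ∈ D r0 ∧
    ∀ F : Fin d → Set (List ℕ), IsVecFan R F → IsRoot F r0 →
      ∀ n, vecLevel F 1 ⊆ vecLevel T n →
        ∀ p < bW, ∀ s, IsConcat W w p s →
          θ ≤ densRel W (l n) (⋂ r ∈ vecLevel F 1, D r) s

section Ultrafilter

attribute [local instance] Ultrafilter.mul Ultrafilter.semigroup

/-- A compact semigroup with continuous right translations has a minimal left ideal. -/
theorem exists_minimal_left_ideal {M : Type*} [Nonempty M] [Semigroup M] [TopologicalSpace M]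
    [CompactSpace M] [T2Space M] (hc : ∀ r : M, Continuous (· * r)) :
    ∃ N : Set M, N.Nonempty ∧ (∀ m, ∀ n ∈ N, m * n ∈ N) ∧
      ∀ n ∈ N, ∀ x ∈ N, ∃ y ∈ N, y * n = x := by
  let I : Set (Set M) := {N | IsClosed N ∧ N.Nonempty ∧ ∀ m, ∀ n ∈ N, m * n ∈ N}
  obtain ⟨N, hN⟩ : ∃ N, Minimal (· ∈ I) N := by
    refine zorn_superset _ fun c hcs hch => ?_
    refine ⟨⋂₀ c, ⟨isClosed_sInter fun t ht => (hcs ht).1, ?_, fun m n hn => ?_⟩,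
      fun s hs => Set.sInter_subset_of_mem hs⟩
    · obtain rfl | hne := c.eq_empty_or_nonempty
      · rw [Set.sInter_empty]
        exact Set.univ_nonempty
      have := hne.coe_sort
      rw [Set.sInter_eq_iInter]
      exact IsCompact.nonempty_iInter_of_directed_nonempty_isCompact_isClosed
        ((↑) : c → Set M) (DirectedOn.directed_val (IsChain.directedOn hch.symm))
        (fun i => (hcs i.prop).2.1) (fun i => (hcs i.prop).1.isCompact)
        (fun i => (hcs i.prop).1)
    · exact Set.mem_sInter.2 fun t ht => (hcs ht).2.2 m n (Set.mem_sInter.1 hn t ht)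
  refine ⟨N, hN.prop.2.1, hN.prop.2.2, fun n hn x hx => ?_⟩
  have himage : (· * n) '' N = N := by
    refine hN.eq_of_subset ⟨(hc n).isClosedMap _ hN.prop.1, ⟨_, n, hn, rfl⟩, ?_⟩ ?_
    · rintro m _ ⟨y, hy, rfl⟩
      exact ⟨m * y, hN.prop.2.2 m y hy, mul_assoc _ _ _⟩
    · rintro _ ⟨y, -, rfl⟩
      exact hN.prop.2.2 y n hn
  rwa [← himage] at hx

theorem ultrafilter_map_mul {M N : Type*} [Semigroup M] [Semigroup N] (h : M →ₙ* N)
    (U V : Ultrafilter M) : (U * V).map h = U.map h * V.map h := by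
  refine Ultrafilter.coe_inj.mp (Filter.ext' fun p => ?_)
  simp only [Ultrafilter.coe_map, Filter.eventually_map, Ultrafilter.eventually_mul, map_mul]

/-- If the homomorphisms `h a : X → M` are retractions of a common section `j`, every nonempty
right ideal of `X` carries an ultrafilter whose images multiply as left zeros. -/
theorem exists_ultrafilter_left_zero {X M A : Type*} [Semigroup X] [Semigroup M] [Nonempty M]
    (h : A → X →ₙ* M) (j : M →ₙ* X) (hj : ∀ a m, h a (j m) = m)
    (I : Set X) (hne : I.Nonempty) (hI : ∀ x ∈ I, ∀ y, x * y ∈ I) :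
    ∃ u : Ultrafilter X, I ∈ u ∧ ∀ a c, u.map (h a) * u.map (h c) = u.map (h a) := by
  obtain ⟨N, ⟨w, hw⟩, hNl, hNm⟩ :=
    exists_minimal_left_ideal (M := Ultrafilter M) Ultrafilter.continuous_mul_left
  let C : Set (Ultrafilter X) := (· * w.map j) '' {v | I ∈ v}
  have hCI : ∀ v ∈ C, I ∈ v := by
    rintro _ ⟨v, hv, rfl⟩
    change ∀ᶠ x in ↑(v * w.map j), x ∈ I
    rw [Ultrafilter.eventually_mul]
    filter_upwards [hv] with x hx
    exact Filter.Eventually.of_forall fun y => hI x hx y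
  have hCN : ∀ v ∈ C, ∀ a, v.map (h a) ∈ N := by
    rintro _ ⟨v, hv, rfl⟩ a
    have hww : (w.map j).map (h a) = w := by
      rw [Ultrafilter.map_map]
      have : (h a) ∘ j = id := funext (hj a)
      rw [this, Ultrafilter.map_id]
    change (v * w.map j).map (h a) ∈ N
    rw [ultrafilter_map_mul, hww]
    exact hNl _ _ hw
  obtain ⟨u, huC, huu⟩ := exists_idempotent_in_compact_subsemigroup
    (Ultrafilter.continuous_mul_left (M := X)) C
    (by
      obtain ⟨x, hx⟩ := hne
      exact ⟨_, pure x, hx, rfl⟩)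
    ((ultrafilter_isClosed_basic I).isCompact.image (Ultrafilter.continuous_mul_left _))
    (by
      rintro x hx _ ⟨y, hy, rfl⟩
      refine ⟨x * y, ?_, mul_assoc _ _ _⟩
      change ∀ᶠ z in ↑(x * y), z ∈ I
      rw [Ultrafilter.eventually_mul]
      filter_upwards [hCI x hx] with z hz
      exact Filter.Eventually.of_forall fun y => hI z hz y)
  refine ⟨u, hCI u huC, fun a c => ?_⟩
  have hidem : u.map (h c) * u.map (h c) = u.map (h c) := by
    rw [← ultrafilter_map_mul, huu]
  obtain ⟨y, -, hy⟩ := hNm _ (hCN u huC c) _ (hCN u huC a)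
  rw [← hy, mul_assoc, hidem]

end Ultrafilter

/-- The word obtained from the left variable word `x · y` (`none` stands for the variable `x`)
by substituting the letter `a` for the variable. -/
def block {A : Type*} (a : A) (y : List (Option A)) : List A := a :: y.map (Option.getD · a)

/-- The word `s ⌢ x₀(a₀) ⌢ ⋯ ⌢ xₙ₋₁(aₙ₋₁)` obtained by substituting the letters of
`σ = (a₀, …, aₙ₋₁)` into the left variable words with tails `y₀, y₁, …`. -/
def spanWord {A : Type*} (s : List A) (y : ℕ → List (Option A)) (σ : List A) : List A :=
  s ++ (σ.mapIdx fun j a => block a (y j)).flatten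

theorem spanWord_concat {A : Type*} (s : List A) (y : ℕ → List (Option A)) (σ : List A) (a : A) :
    spanWord s y (σ ++ [a]) = spanWord s y σ ++ block a (y σ.length) := by
  simp [spanWord, List.mapIdx_concat]

theorem exists_ultrafilter_block (A : Type*) :
    ∃ u : Ultrafilter (List (Option A)), ∀ (a c : A) (P : List A → Prop),
      (∀ᶠ y in (u : Filter (List (Option A))), ∀ᶠ z in (u : Filter (List (Option A))),
        P (block a y ++ block c z)) ↔ ∀ᶠ y in (u : Filter (List (Option A))), P (block a y) := by
  let I : Set (FreeMonoid (Option A)) := {x | ∃ y : List (Option A), x.toList = none :: y}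
  let hom : A → FreeMonoid (Option A) →ₙ* FreeMonoid A :=
    fun a => (FreeMonoid.map (Option.getD · a) : FreeMonoid (Option A) →* FreeMonoid A)
  obtain ⟨u, huI, hu⟩ := exists_ultrafilter_left_zero hom
    ((FreeMonoid.map some : FreeMonoid A →* FreeMonoid (Option A)) : FreeMonoid A →ₙ* _)
    (fun a m => by
      have hm : List.map (Option.getD · a) (List.map some m.toList) = m.toList := by simp
      exact hm) I ⟨FreeMonoid.of none, [], rfl⟩
    (by
      rintro x ⟨y, hy⟩ z
      exact ⟨y ++ z.toList, by simp [FreeMonoid.toList_mul, hy]⟩)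
  have hev : ∀ (a : A) (y : FreeMonoid (Option A)), y ∈ I →
      block a (y.toList.tail) = (hom a y).toList := by
    rintro a y ⟨z, hz⟩
    change _ = List.map (Option.getD · a) y.toList
    simp [hz, block]
  refine ⟨u.map fun x => x.toList.tail, fun a c P => ?_⟩
  have key := congrArg (fun v : Ultrafilter (FreeMonoid A) =>
    ∀ᶠ m in (v : Filter (FreeMonoid A)), P m.toList) (hu a c)
  simp only [Ultrafilter.coe_map, Filter.eventually_map, Ultrafilter.eventually_mul,
    FreeMonoid.toList_mul] at key ⊢
  have hleft : (∀ᶠ x in (u : Filter (FreeMonoid (Option A))), P (block a x.toList.tail)) ↔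
      ∀ᶠ x in (u : Filter (FreeMonoid (Option A))), P (hom a x).toList :=
    Filter.eventually_congr (by filter_upwards [huI] with x hx; rw [hev a x hx])
  rw [hleft, ← key]
  refine Filter.eventually_congr ?_
  filter_upwards [huI] with x hx
  refine Filter.eventually_congr ?_
  filter_upwards [huI] with z hz
  rw [hev a x hx, hev c z hz]

/-- Fusion: a set `G` of words that is closed under almost all substitutions contains the span of
a sequence of left variable words, the `n`-th level of which lies in `P n`. -/
theorem exists_span_of_eventually {A : Type*} [Finite A] (u : Ultrafilter (List (Option A)))
    (G : Set (List A)) (P : ℕ → List A → Prop)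
    (hG : ∀ s ∈ G, ∀ n, ∀ a, ∀ᶠ y in (u : Filter (List (Option A))),
      s ++ block a y ∈ G ∧ P n (s ++ block a y))
    (s : List A) (hs : s ∈ G) (h0 : P 0 s) :
    ∃ y : ℕ → List (Option A), ∀ σ, P σ.length (spanWord s y σ) := by
  have step : ∀ n (Ω : {Ω : Set (List A) // Ω.Finite ∧ Ω ⊆ G}), ∃ y : List (Option A),
      ∀ t ∈ Ω.1, ∀ a, t ++ block a y ∈ G ∧ P (n + 1) (t ++ block a y) := by
    rintro n ⟨Ω, hfin, hsub⟩
    have : ∀ᶠ y in (u : Filter (List (Option A))),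
        ∀ t ∈ Ω, ∀ a, t ++ block a y ∈ G ∧ P (n + 1) (t ++ block a y) :=
      (Filter.eventually_all_finite hfin).2 fun t ht =>
        Filter.eventually_all.2 fun a => hG t (hsub ht) (n + 1) a
    exact this.exists
  choose ch hch using step
  let next : ℕ → {Ω : Set (List A) // Ω.Finite ∧ Ω ⊆ G} → {Ω : Set (List A) // Ω.Finite ∧ Ω ⊆ G} :=
    fun n Ω => ⟨Set.image2 (fun t a => t ++ block a (ch n Ω)) Ω.1 Set.univ,
      Ω.2.1.image2 _ Set.finite_univ, by
        rintro _ ⟨t, ht, a, -, rfl⟩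
        exact (hch n Ω t ht a).1⟩
  let Ω : ℕ → {Ω : Set (List A) // Ω.Finite ∧ Ω ⊆ G} := fun n =>
    Nat.rec ⟨{s}, Set.finite_singleton s, by simpa using hs⟩ next n
  have hΩ : ∀ σ, spanWord s (fun n => ch n (Ω n)) σ ∈ (Ω σ.length).1 := by
    intro σ
    induction σ using List.reverseRecOn with
    | nil => simp [spanWord, Ω]
    | append_singleton σ a ih =>
      rw [spanWord_concat, List.length_append]
      exact ⟨_, ih, a, Set.mem_univ _, rfl⟩
  refine ⟨fun n => ch n (Ω n), fun σ => ?_⟩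
  induction σ using List.reverseRecOn with
  | nil => simpa [spanWord] using h0
  | append_singleton σ a _ =>
    rw [spanWord_concat, List.length_append]
    exact (hch _ _ _ (hΩ σ) a).2

/-- If no span of left variable words keeps all the functions `ρ · i p`, `p : B`, uniformly away
from zero, then some span makes `ρ · i (φ i)` decay as fast as desired. -/
theorem exists_span_decay {A ι B : Type*} [Finite A] [Nonempty A] [Finite ι] [Finite B]
    (ρ : List A → ι → B → ℝ)
    (hρ : ∀ (s : List A) (y : ℕ → List (Option A)) (i : ι) (θ : ℝ), 0 < θ →
      ¬ ∀ σ p, θ ≤ ρ (spanWord s y σ) i p)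
    (θ : ℕ → ℝ) (hθ : ∀ n, 0 < θ n) :
    ∃ (s : List A) (y : ℕ → List (Option A)) (φ : ι → B),
      ∀ σ i, ρ (spanWord s y σ) i (φ i) < θ σ.length := by
  obtain ⟨u, hu⟩ := exists_ultrafilter_block A
  have hu' : ∀ (s : List A) (a c : A) (P : List A → Prop),
      (∀ᶠ y in (u : Filter (List (Option A))), P (s ++ block a y)) →
      ∀ᶠ y in (u : Filter (List (Option A))), ∀ᶠ z in (u : Filter (List (Option A))),
        P (s ++ block a y ++ block c z) := by
    intro s a c P hP
    simpa only [List.append_assoc] using (hu a c fun t => P (s ++ t)).2 hP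
  let Z : List A → A → ι → B → Prop := fun s a i p =>
    ∀ δ > 0, ∀ᶠ y in (u : Filter (List (Option A))), ρ (s ++ block a y) i p < δ
  have hZ : ∀ s a i, ∃ p, Z s a i p := by
    intro s a i
    by_contra! hcon
    have hcon' : ∀ p, ∃ δ > 0, ∀ᶠ y in (u : Filter (List (Option A))),
        δ ≤ ρ (s ++ block a y) i p := by
      intro p
      have := hcon p
      simp only [Z, not_forall] at this
      obtain ⟨δ, hδ, h⟩ := this
      refine ⟨δ, hδ, ?_⟩
      simpa only [not_lt] using Ultrafilter.eventually_not.2 h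
    choose δ hδ hδρ using hcon'
    obtain ⟨η, hη, hηδ⟩ : ∃ η > 0, ∀ p, η ≤ δ p := by
      cases isEmpty_or_nonempty B
      · exact ⟨1, one_pos, isEmptyElim⟩
      · obtain ⟨p, hp⟩ := Finite.exists_min δ
        exact ⟨δ p, hδ p, hp⟩
    have hP : ∀ᶠ y in (u : Filter (List (Option A))), ∀ p, η ≤ ρ (s ++ block a y) i p := by
      refine Filter.eventually_all.2 fun p => ?_
      filter_upwards [hδρ p] with y hy using (hηδ p).trans hy
    let G : Set (List A) := {t | ∀ c, ∀ᶠ y in (u : Filter (List (Option A))),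
      ∀ p, η ≤ ρ (t ++ block c y) i p}
    have hstart : ∀ᶠ y in (u : Filter (List (Option A))), s ++ block a y ∈ G :=
      Filter.eventually_all.2 fun c => hu' s a c (fun t => ∀ p, η ≤ ρ t i p) hP
    obtain ⟨y, hyG, hyP⟩ := (hstart.and hP).exists
    obtain ⟨y', hy'⟩ := exists_span_of_eventually u G (fun _ t => ∀ p, η ≤ ρ t i p)
      (fun t ht _ a => (Filter.eventually_all.2 fun c =>
        hu' t a c (fun t => ∀ p, η ≤ ρ t i p) (ht a)).and (ht a)) _ hyG hyP
    exact hρ _ y' i η hη hy'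
  obtain ⟨a₀⟩ := ‹Nonempty A›
  obtain ⟨ζ, hζ⟩ : ∃ ζ : A → ι → B → Prop,
      ∀ᶠ y in (u : Filter (List (Option A))), Z (block a₀ y) = ζ := by
    have : ∀ᶠ y in (u : Filter (List (Option A))),
        ∃ ζ ∈ (Set.univ : Set (A → ι → B → Prop)), Z (block a₀ y) = ζ :=
      Filter.Eventually.of_forall fun y => ⟨_, trivial, rfl⟩
    obtain ⟨ζ, -, h⟩ := (Ultrafilter.eventually_exists_mem_iff Set.finite_univ).1 this
    exact ⟨ζ, h⟩
  let G : Set (List A) := {t | Z t = ζ ∧ ∀ c, ∀ᶠ y in (u : Filter (List (Option A))),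
    Z (t ++ block c y) = ζ}
  have hGstep : ∀ t ∈ G, ∀ a, ∀ᶠ y in (u : Filter (List (Option A))), t ++ block a y ∈ G :=
    fun t ht a => (ht.2 a).and (Filter.eventually_all.2 fun c =>
      hu' t a c (fun t => Z t = ζ) (ht.2 a))
  obtain ⟨s, hsG⟩ : ∃ s, s ∈ G := by
    have := hζ.and (Filter.eventually_all.2 fun c => hu' [] a₀ c (fun t => Z t = ζ) hζ)
    obtain ⟨y, hy⟩ := this.exists
    exact ⟨_, hy⟩
  choose φ hφ using hZ s a₀
  have hφζ : ∀ a i, ζ a i (φ i) := by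
    intro a i
    rw [← hsG.1]
    intro δ hδ
    have h1 : ∀ᶠ y in (u : Filter (List (Option A))), ∀ᶠ z in (u : Filter (List (Option A))),
        ρ (s ++ (block a y ++ block a₀ z)) i (φ i) < δ := by
      filter_upwards [hsG.2 a] with y hy
      have : Z (s ++ block a y) a₀ i (φ i) := by
        rw [hy, ← hsG.1]
        exact hφ i
      simpa only [List.append_assoc] using this δ hδ
    exact (hu a a₀ fun t => ρ (s ++ t) i (φ i) < δ).1 h1
  have hstep : ∀ t ∈ G, ∀ n, ∀ a, ∀ᶠ y in (u : Filter (List (Option A))),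
      t ++ block a y ∈ G ∧ ∀ i, ρ (t ++ block a y) i (φ i) < θ n := by
    intro t ht n a
    refine (hGstep t ht a).and (Filter.eventually_all.2 fun i => ?_)
    have : Z t a i (φ i) := by
      rw [ht.1]
      exact hφζ a i
    exact this _ (hθ n)
  obtain ⟨y, hyG, hyθ⟩ := (hstep s hsG 0 a₀).exists
  obtain ⟨y', hy'⟩ := exists_span_of_eventually u G (fun n t => ∀ i, ρ t i (φ i) < θ n) hstep
    _ hyG hyθ
  exact ⟨_, y', φ, hy'⟩

theorem concat_mem_bSeq {b : ℕ} {σ : List ℕ} {p : ℕ} :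
    σ ++ [p] ∈ bSeq b ↔ σ ∈ bSeq b ∧ p < b := by
  simp only [bSeq, Set.mem_ofPred_eq, List.mem_append, List.mem_singleton]
  exact ⟨fun h => ⟨fun x hx => h x (Or.inl hx), h p (Or.inr rfl)⟩,
    fun h x hx => hx.elim (h.1 x) fun hxp => hxp ▸ h.2⟩

theorem mem_bSeq_of_prefix {b : ℕ} {σ τ : List ℕ} (h : σ <+: τ) (hτ : τ ∈ bSeq b) :
    σ ∈ bSeq b := fun x hx => hτ x (h.subset hx)

theorem nil_mem_bSeq (b : ℕ) : [] ∈ bSeq b := by simp [bSeq]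

theorem prefix_antisymm {σ τ : List ℕ} (h : σ <+: τ) (h' : τ <+: σ) : σ = τ :=
  h.eq_of_length (le_antisymm h.length_le h'.length_le)

theorem exists_concat_prefix {σ τ : List ℕ} (h : σ <+: τ) (hne : σ ≠ τ) :
    ∃ p, σ ++ [p] <+: τ := by
  obtain ⟨ρ, rfl⟩ := h
  cases ρ with
  | nil => simp at hne
  | cons p ρ => exact ⟨p, ρ, by simp⟩

theorem eq_of_concat_prefix {σ τ : List ℕ} {p q : ℕ} (hp : σ ++ [p] <+: τ)
    (hq : σ ++ [q] <+: τ) : p = q := by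
  have h := (List.prefix_of_prefix_length_le hp hq (by simp)).eq_of_length (by simp)
  simpa using h

theorem prefix_or_exists_branching (σ τ : List ℕ) :
    σ <+: τ ∨ ∃ ρ p, ρ ++ [p] <+: σ ∧ ρ <+: τ ∧ ¬ ρ ++ [p] <+: τ := by
  induction σ using List.reverseRecOn with
  | nil => exact Or.inl List.nil_prefix
  | append_singleton σ p ih =>
    obtain h | ⟨ρ, q, h1, h2⟩ := ih
    · by_cases hp : σ ++ [p] <+: τ
      · exact Or.inl hp
      · exact Or.inr ⟨σ, p, List.prefix_rfl, h, hp⟩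
    · exact Or.inr ⟨ρ, q, h1.trans (List.prefix_append _ _), h2⟩

/-- `f` maps the immediate successor of `σ` in direction `p` above `f σ ⌢ p`. -/
def DirPreserving (b : ℕ) (f : List ℕ → List ℕ) : Prop :=
  ∀ σ ∈ bSeq b, ∀ p < b, f σ ++ [p] <+: f (σ ++ [p])

namespace DirPreserving

variable {b : ℕ} {f g : List ℕ → List ℕ}

theorem mono (hf : DirPreserving b f) {σ τ : List ℕ} (hτ : τ ∈ bSeq b) (h : σ <+: τ) :
    f σ <+: f τ := by
  induction τ using List.reverseRecOn with
  | nil => rw [List.prefix_nil.1 h]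
  | append_singleton τ p ih =>
    obtain h | h := List.prefix_concat_iff.1 h
    · rw [h]
    · obtain ⟨hτ, hp⟩ := concat_mem_bSeq.1 hτ
      exact (ih hτ h).trans ((List.prefix_append _ _).trans (hf τ hτ p hp))

theorem concat_prefix (hf : DirPreserving b f) {σ τ : List ℕ} {p : ℕ} (hτ : τ ∈ bSeq b)
    (h : σ ++ [p] <+: τ) : f σ ++ [p] <+: f τ := by
  obtain ⟨hσ, hp⟩ := concat_mem_bSeq.1 (mem_bSeq_of_prefix h hτ)
  exact (hf σ hσ p hp).trans (hf.mono hτ h)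

theorem prefix_iff (hf : DirPreserving b f) {σ τ : List ℕ} (hσ : σ ∈ bSeq b) (hτ : τ ∈ bSeq b) :
    f σ <+: f τ ↔ σ <+: τ := by
  refine ⟨fun h => ?_, hf.mono hτ⟩
  obtain h' | ⟨ρ, p, h1, h2, h3⟩ := prefix_or_exists_branching σ τ
  · exact h'
  · have hp := (hf.concat_prefix hσ h1).trans h
    by_cases hρ : ρ = τ
    · have := hp.length_le
      simp [hρ] at this
    · obtain ⟨q, hq⟩ := exists_concat_prefix h2 hρ
      rw [eq_of_concat_prefix hp (hf.concat_prefix hτ hq)] at h3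
      exact absurd hq h3

theorem injOn (hf : DirPreserving b f) : Set.InjOn f (bSeq b) := fun _ hσ _ hτ h =>
  prefix_antisymm ((hf.prefix_iff hσ hτ).1 (h ▸ List.prefix_rfl))
    ((hf.prefix_iff hτ hσ).1 (h ▸ List.prefix_rfl))

theorem comp (hf : DirPreserving b f) (hg : DirPreserving b g)
    (hgb : Set.MapsTo g (bSeq b) (bSeq b)) :
    DirPreserving b (f ∘ g) := fun σ hσ p hp =>
  hf.concat_prefix (hgb (concat_mem_bSeq.2 ⟨hσ, hp⟩)) (hg σ hσ p hp)

end DirPreserving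

theorem eq_of_mem_level {T : Set (List ℕ)} {n m : ℕ} {t : List ℕ} (hn : t ∈ level T n)
    (hm : t ∈ level T m) : n = m := hn.2.symm.trans hm.2

/-- `f` is a direction preserving enumeration of the tree `T` by `b^{<ℕ}`. -/
def IsParam (b : ℕ) (T : Set (List ℕ)) (f : List ℕ → List ℕ) : Prop :=
  T = f '' bSeq b ∧ DirPreserving b f

theorem ncard_strict_prefixes (σ : List ℕ) : {ρ | ρ <+: σ ∧ ρ ≠ σ}.ncard = σ.length := by
  have h : {ρ | ρ <+: σ ∧ ρ ≠ σ} = (fun k => σ.take k) '' Set.Iio σ.length := by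
    ext ρ
    constructor
    · rintro ⟨h1, h2⟩
      refine ⟨ρ.length, lt_of_le_of_ne h1.length_le fun h => h2 (h1.eq_of_length h), ?_⟩
      exact (List.prefix_iff_eq_take.1 h1).symm
    · rintro ⟨k, hk, rfl⟩
      refine ⟨List.take_prefix _ _, fun h => ?_⟩
      have := congrArg List.length h
      simp only [List.length_take] at this
      simp only [Set.mem_Iio] at hk
      omega
  rw [h, Set.InjOn.ncard_image]
  · simp [← Finset.coe_Iio, Set.ncard_coe_finset]
  · intro k hk k' hk' h
    have := congrArg List.length h
    simp only [List.length_take, Set.mem_Iio] at this hk hk'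
    omega

namespace IsParam

variable {b : ℕ} {T : Set (List ℕ)} {f : List ℕ → List ℕ}

theorem apply_mem (h : IsParam b T f) {σ : List ℕ} (hσ : σ ∈ bSeq b) : f σ ∈ T :=
  h.1 ▸ ⟨σ, hσ, rfl⟩

theorem apply_mem_level_iff (h : IsParam b T f) {σ : List ℕ} (hσ : σ ∈ bSeq b) {n : ℕ} :
    f σ ∈ level T n ↔ σ.length = n := by
  have hset : {s ∈ T | s <+: f σ ∧ s ≠ f σ} = f '' {ρ | ρ <+: σ ∧ ρ ≠ σ} := by
    ext s
    constructor
    · rintro ⟨hs, h1, h2⟩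
      rw [h.1] at hs
      obtain ⟨ρ, hρ, rfl⟩ := hs
      exact ⟨ρ, ⟨(h.2.prefix_iff hρ hσ).1 h1, fun e => h2 (e ▸ rfl)⟩, rfl⟩
    · rintro ⟨ρ, ⟨h1, h2⟩, rfl⟩
      have hρ := mem_bSeq_of_prefix h1 hσ
      exact ⟨h.apply_mem hρ, h.2.mono hσ h1, fun e => h2 (h.2.injOn hρ hσ e)⟩
  have hcard : {s ∈ T | s <+: f σ ∧ s ≠ f σ}.ncard = σ.length := by
    rw [hset, Set.InjOn.ncard_image
      (h.2.injOn.mono fun ρ hρ => mem_bSeq_of_prefix hρ.1 hσ), ncard_strict_prefixes]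
  simp only [level, Set.mem_ofPred_eq, hcard, h.apply_mem hσ, true_and]

theorem level_eq (h : IsParam b T f) (n : ℕ) :
    level T n = f '' {σ | σ ∈ bSeq b ∧ σ.length = n} := by
  ext t
  constructor
  · intro ht
    obtain ⟨σ, hσ, rfl⟩ : t ∈ f '' bSeq b := h.1 ▸ ht.1
    exact ⟨σ, ⟨hσ, (h.apply_mem_level_iff hσ).1 ht⟩, rfl⟩
  · rintro ⟨σ, ⟨hσ, hn⟩, rfl⟩
    exact (h.apply_mem_level_iff hσ).2 hn

theorem level_zero (h : IsParam b T f) : level T 0 = {f []} := by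
  have h0 : {σ | σ ∈ bSeq b ∧ σ.length = 0} = {[]} := by
    ext σ
    simp only [Set.mem_ofPred_eq, List.length_eq_zero_iff, Set.mem_singleton_iff,
      and_iff_right_iff_imp]
    rintro rfl
    exact nil_mem_bSeq b
  rw [h.level_eq, h0, Set.image_singleton]

theorem level_one (h : IsParam b T f) : level T 1 = {t | ∃ p < b, t = f [p]} := by
  rw [h.level_eq]
  ext t
  constructor
  · rintro ⟨σ, ⟨hσ, hn⟩, rfl⟩
    obtain ⟨p, rfl⟩ := List.length_eq_one_iff.1 hn
    exact ⟨p, hσ p (by simp), rfl⟩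
  · rintro ⟨p, hp, rfl⟩
    exact ⟨[p], ⟨by simpa [bSeq] using hp, rfl⟩, rfl⟩

theorem level_finite (h : IsParam b T f) (n : ℕ) : (level T n).Finite := by
  rw [h.level_eq]
  refine Set.Finite.image f (((List.finite_length_eq (Fin b) n).image
    (List.map fun x : Fin b => (x : ℕ))).subset ?_)
  rintro σ ⟨hσ, hn⟩
  refine ⟨σ.attach.map fun x => ⟨x.1, hσ x.1 x.2⟩, by simpa using hn, ?_⟩
  simp

theorem immSuc_iff (h : IsParam b T f) {σ t : List ℕ} (hσ : σ ∈ bSeq b) :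
    ImmSuc T (f σ) t ↔ ∃ p < b, t = f (σ ++ [p]) := by
  constructor
  · rintro ⟨-, ht, h1, h2, h3⟩
    obtain ⟨τ, hτ, rfl⟩ : t ∈ f '' bSeq b := h.1 ▸ ht
    obtain ⟨p, hp⟩ := exists_concat_prefix ((h.2.prefix_iff hσ hτ).1 h1) fun e => h2 (e ▸ rfl)
    have hσp := mem_bSeq_of_prefix hp hτ
    refine ⟨p, (concat_mem_bSeq.1 hσp).2, ?_⟩
    obtain h4 | h4 := h3 _ (h.apply_mem hσp) (h.2.mono hσp (List.prefix_append _ _))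
      (h.2.mono hτ hp)
    · simpa using h.2.injOn hσp hσ h4
    · exact h4.symm
  · rintro ⟨p, hp, rfl⟩
    have hσp := concat_mem_bSeq.2 ⟨hσ, hp⟩
    refine ⟨h.apply_mem hσ, h.apply_mem hσp, h.2.mono hσp (List.prefix_append _ _),
      fun e => by simpa using h.2.injOn hσ hσp e, fun u hu h1 h2 => ?_⟩
    obtain ⟨ρ, hρ, rfl⟩ : u ∈ f '' bSeq b := h.1 ▸ hu
    have h1 := (h.2.prefix_iff hσ hρ).1 h1
    obtain h2 | h2 := List.prefix_concat_iff.1 ((h.2.prefix_iff hρ hσp).1 h2)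
    · exact Or.inr (h2 ▸ rfl)
    · exact Or.inl (prefix_antisymm h1 h2 ▸ rfl)

theorem concat_unique (h : IsParam b T f) {w s s' : List ℕ} {p : ℕ} (hs : IsConcat T w p s)
    (hs' : IsConcat T w p s') : s = s' := by
  obtain ⟨σ, hσ, rfl⟩ : w ∈ f '' bSeq b := h.1 ▸ hs.1.1
  obtain ⟨q, hq, rfl⟩ := (h.immSuc_iff hσ).1 hs.1
  obtain ⟨q', hq', rfl⟩ := (h.immSuc_iff hσ).1 hs'.1
  rw [eq_of_concat_prefix (h.2 σ hσ q hq) hs.2, eq_of_concat_prefix (h.2 σ hσ q' hq') hs'.2]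

end IsParam

theorem isParam_bSeq (b : ℕ) : IsParam b (bSeq b) id :=
  ⟨by simp, fun _ _ _ _ => List.prefix_rfl⟩

/-- `g` is a direction preserving self-map of `b^{<ℕ}` sending level `n` to level `L n`. -/
structure IsStrongEmb (b : ℕ) (L : ℕ → ℕ) (g : List ℕ → List ℕ) : Prop where
  mapsTo : Set.MapsTo g (bSeq b) (bSeq b)
  length_eq : ∀ σ ∈ bSeq b, (g σ).length = L σ.length
  dir : DirPreserving b g

theorem IsStrongEmb.comp {b : ℕ} {L L' : ℕ → ℕ} {g g' : List ℕ → List ℕ}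
    (h : IsStrongEmb b L g) (h' : IsStrongEmb b L' g') : IsStrongEmb b (L ∘ L') (g ∘ g') where
  mapsTo := h.mapsTo.comp h'.mapsTo
  length_eq σ hσ := by
    rw [Function.comp_apply, h.length_eq _ (h'.mapsTo hσ), h'.length_eq σ hσ, Function.comp_apply]
  dir := h.dir.comp h'.dir h'.mapsTo

theorem IsParam.comp {b : ℕ} {L : ℕ → ℕ} {T : Set (List ℕ)} {f g : List ℕ → List ℕ}
    (hf : IsParam b T f) (hg : IsStrongEmb b L g) : IsParam b ((f ∘ g) '' bSeq b) (f ∘ g) :=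
  ⟨rfl, hf.2.comp hg.dir hg.mapsTo⟩

theorem IsParam.isStrongSubtreeWith {b : ℕ} {L : ℕ → ℕ} {T : Set (List ℕ)}
    {f g : List ℕ → List ℕ} (hf : IsParam b T f) (hg : IsStrongEmb b L g) (hL : StrictMono L) :
    IsStrongSubtreeWith T ((f ∘ g) '' bSeq b) L := by
  have hp := hf.comp hg
  refine ⟨?_, ?_, hL, ?_, ?_⟩
  · rintro _ ⟨σ, hσ, rfl⟩
    exact hf.apply_mem (hg.mapsTo hσ)
  · rw [UniquelyRooted, hp.level_zero]
    exact ⟨_, rfl, fun _ h => h⟩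
  · intro n
    rw [hp.level_eq]
    rintro _ ⟨σ, ⟨hσ, rfl⟩, rfl⟩
    exact (hf.apply_mem_level_iff (hg.mapsTo hσ)).2 (hg.length_eq σ hσ)
  · rintro _ ⟨σ, hσ, rfl⟩ t ht
    obtain ⟨p, hpb, rfl⟩ := (hf.immSuc_iff (hg.mapsTo hσ)).1 ht
    refine ⟨(f ∘ g) (σ ++ [p]), ⟨(hp.immSuc_iff hσ).2 ⟨p, hpb, rfl⟩, ?_⟩, ?_⟩
    · exact hf.2.mono (hg.mapsTo (concat_mem_bSeq.2 ⟨hσ, hpb⟩)) (hg.dir σ hσ p hpb)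
    · rintro s' ⟨h1, h2⟩
      obtain ⟨q, hq, rfl⟩ := (hp.immSuc_iff hσ).1 h1
      have hσq := hg.mapsTo (concat_mem_bSeq.2 ⟨hσ, hq⟩)
      have h3 := (hf.2.prefix_iff (concat_mem_bSeq.2 ⟨hg.mapsTo hσ, hpb⟩) hσq).1 h2
      rw [eq_of_concat_prefix h3 (hg.dir σ hσ q hq)]

theorem exists_immSuc_of_not_minimal {S : Set (List ℕ)} {s : List ℕ} (hs : s ∈ S)
    (h0 : s ∉ level S 0) : ∃ t, ImmSuc S t s ∧ t.length < s.length := by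
  have hfin : {t ∈ S | t <+: s ∧ t ≠ s}.Finite :=
    s.inits.toFinset.finite_toSet.subset fun t ht => by simpa using ht.2.1
  have hne : {t ∈ S | t <+: s ∧ t ≠ s}.Nonempty := by
    by_contra hne
    rw [Set.not_nonempty_iff_eq_empty] at hne
    exact h0 ⟨hs, by rw [hne, Set.ncard_empty]⟩
  obtain ⟨t, ⟨htS, hts, htn⟩, hmax⟩ := hfin.exists_maximalFor List.length _ hne
  refine ⟨t, ⟨htS, hs, hts, htn, fun u hu h1 h2 => ?_⟩,
    lt_of_le_of_ne hts.length_le fun e => htn (hts.eq_of_length e)⟩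
  by_cases hus : u = s
  · exact Or.inr hus
  · exact Or.inl (h1.eq_of_length (le_antisymm h1.length_le (hmax ⟨hu, h2, hus⟩ h1.length_le))).symm

/-- A strong subtree of an enumerated tree is the image of a strong embedding. -/
theorem IsParam.exists_strongEmb {b : ℕ} {L : ℕ → ℕ} {T S : Set (List ℕ)} {f : List ℕ → List ℕ}
    (hf : IsParam b T f) (hS : IsStrongSubtreeWith T S L) :
    ∃ g, IsStrongEmb b L g ∧ S = (f ∘ g) '' bSeq b := by
  obtain ⟨hST, ⟨r, hr, hru⟩, -, hlev, hsucc⟩ := hS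
  have hsucc' : ∀ σ ∈ bSeq b, f σ ∈ S → ∀ p < b,
      ∃! s', ImmSuc S (f σ) s' ∧ f (σ ++ [p]) <+: s' := fun σ hσ hs p hp =>
    hsucc _ hs _ ((hf.immSuc_iff hσ).2 ⟨p, hp, rfl⟩)
  have hg : ∀ (σ : List ℕ) (p : ℕ), ∃ τ, σ ∈ bSeq b → f σ ∈ S → p < b →
      τ ∈ bSeq b ∧ ImmSuc S (f σ) (f τ) ∧ σ ++ [p] <+: τ := by
    intro σ p
    by_cases h : σ ∈ bSeq b ∧ f σ ∈ S ∧ p < b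
    · obtain ⟨s', ⟨h1, h2⟩, -⟩ := hsucc' σ h.1 h.2.1 p h.2.2
      obtain ⟨τ, hτ, rfl⟩ : s' ∈ f '' bSeq b := hf.1 ▸ hST h1.2.1
      exact ⟨τ, fun _ _ _ =>
        ⟨hτ, h1, (hf.2.prefix_iff (concat_mem_bSeq.2 ⟨h.1, h.2.2⟩) hτ).1 h2⟩⟩
    · exact ⟨[], fun h1 h2 h3 => absurd ⟨h1, h2, h3⟩ h⟩
  choose next hnext using hg
  obtain ⟨ρ, hρ, rfl⟩ : r ∈ f '' bSeq b := hf.1 ▸ hST hr.1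
  let g : List ℕ → List ℕ := fun σ => σ.foldl next ρ
  have hgc : ∀ σ p, g (σ ++ [p]) = next (g σ) p := fun σ p => by simp [g]
  have hgS : ∀ σ ∈ bSeq b, g σ ∈ bSeq b ∧ f (g σ) ∈ S := by
    intro σ
    induction σ using List.reverseRecOn with
    | nil => exact fun _ => ⟨hρ, hr.1⟩
    | append_singleton σ p ih =>
      intro hσ
      obtain ⟨hσ, hp⟩ := concat_mem_bSeq.1 hσ
      obtain ⟨h1, h2, -⟩ := hnext (g σ) p (ih hσ).1 (ih hσ).2 hp
      rw [hgc]
      exact ⟨h1, h2.2.1⟩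
  have hdir : DirPreserving b g := fun σ hσ p hp => by
    rw [hgc]
    exact (hnext (g σ) p (hgS σ hσ).1 (hgS σ hσ).2 hp).2.2
  have hmaps : Set.MapsTo g (bSeq b) (bSeq b) := fun σ hσ => (hgS σ hσ).1
  have hsub : ∀ n, ∀ s ∈ S, s.length = n → s ∈ (f ∘ g) '' bSeq b := by
    intro n
    induction n using Nat.strong_induction_on with
    | _ n ih =>
      intro s hs hn
      by_cases h0 : s ∈ level S 0
      · rw [hru s h0]
        exact ⟨[], nil_mem_bSeq b, rfl⟩
      · obtain ⟨t, hts, hlen⟩ := exists_immSuc_of_not_minimal hs h0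
        obtain ⟨σ, hσ, rfl⟩ := ih _ (hn ▸ hlen) t hts.1 rfl
        obtain ⟨τ, hτ, rfl⟩ : s ∈ f '' bSeq b := hf.1 ▸ hST hs
        have hpre := (hf.2.prefix_iff (hmaps hσ) hτ).1 hts.2.2.1
        obtain ⟨p, hp⟩ := exists_concat_prefix hpre fun e => hts.2.2.2.1 (by simp [e])
        have hpb := (concat_mem_bSeq.1 (mem_bSeq_of_prefix hp hτ)).2
        refine ⟨σ ++ [p], concat_mem_bSeq.2 ⟨hσ, hpb⟩, ?_⟩
        obtain ⟨h1, h2, h3⟩ := hnext (g σ) p (hgS σ hσ).1 (hgS σ hσ).2 hpb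
        rw [Function.comp_apply, hgc]
        exact (hsucc' (g σ) (hmaps hσ) (hgS σ hσ).2 p hpb).unique
          ⟨h2, hf.2.mono h1 h3⟩ ⟨hts, hf.2.mono hτ hp⟩
  have hSeq : S = (f ∘ g) '' bSeq b := by
    refine Set.Subset.antisymm (fun s hs => hsub _ s hs rfl) ?_
    rintro _ ⟨σ, hσ, rfl⟩
    exact (hgS σ hσ).2
  refine ⟨g, ⟨hmaps, fun σ hσ => ?_, hdir⟩, hSeq⟩
  have hSp : IsParam b S (f ∘ g) := ⟨hSeq, hf.2.comp hdir hmaps⟩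
  exact (hf.apply_mem_level_iff (hmaps hσ)).1
    (hlev _ ((hSp.apply_mem_level_iff hσ).2 rfl))

theorem IsHomogeneous.exists_param {b : ℕ} {T : Set (List ℕ)} (h : IsHomogeneous b T) :
    ∃ f, IsParam b T f := by
  obtain ⟨-, l, hl⟩ := h
  obtain ⟨g, hg, hT⟩ := (isParam_bSeq b).exists_strongEmb hl
  exact ⟨id ∘ g, hT, hg.dir⟩

theorem IsParam.level_fan {b : ℕ} {R F : Set (List ℕ)} {f : List ℕ → List ℕ} (hf : IsParam b R f)
    (hF : F = level R 0 ∪ level R 1) {n : ℕ} (hn : n ≤ 1) : level F n = level R n := by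
  have hmem : ∀ σ ∈ bSeq b, f σ ∈ F ↔ σ.length ≤ 1 := fun σ hσ => by
    rw [hF, Set.mem_union, hf.apply_mem_level_iff hσ, hf.apply_mem_level_iff hσ]
    omega
  have hFR : F ⊆ R := by
    rw [hF]
    rintro t (ht | ht) <;> exact ht.1
  have hpred : ∀ t ∈ F, {s ∈ F | s <+: t ∧ s ≠ t} = {s ∈ R | s <+: t ∧ s ≠ t} := by
    intro t ht
    ext s
    refine ⟨fun hs => ⟨hFR hs.1, hs.2⟩, fun hs => ⟨?_, hs.2⟩⟩
    obtain ⟨σ, hσ, rfl⟩ : s ∈ f '' bSeq b := hf.1 ▸ hs.1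
    obtain ⟨τ, hτ, rfl⟩ : t ∈ f '' bSeq b := hf.1 ▸ hFR ht
    exact (hmem σ hσ).2 (((hf.2.prefix_iff hσ hτ).1 hs.2.1).length_le.trans ((hmem τ hτ).1 ht))
  ext t
  constructor
  · rintro ⟨ht, hc⟩
    exact ⟨hFR ht, hpred t ht ▸ hc⟩
  · rintro ⟨ht, hc⟩
    have htF : t ∈ F := by
      obtain ⟨τ, hτ, rfl⟩ : t ∈ f '' bSeq b := hf.1 ▸ ht
      rw [hmem τ hτ, (hf.apply_mem_level_iff hτ).1 ⟨ht, hc⟩]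
      exact hn
    exact ⟨htF, (hpred t htF).symm ▸ hc⟩

theorem IsVecFan.exists_strongEmb {d : ℕ} {b : Fin d → ℕ} {S F : Fin d → Set (List ℕ)}
    {k : Fin d → List ℕ → List ℕ} (hk : ∀ i, IsParam (b i) (S i) (k i)) (hF : IsVecFan S F) :
    ∃ (L : ℕ → ℕ) (g : Fin d → List ℕ → List ℕ), ∀ i, StrictMono L ∧
      IsStrongEmb (b i) L (g i) ∧ F i = level (F i) 0 ∪ level (F i) 1 ∧
      level (F i) 0 = {k i (g i [])} ∧ level (F i) 1 = {t | ∃ p < b i, t = k i (g i [p])} := by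
  obtain ⟨R, ⟨L, hL⟩, hFR⟩ := hF
  choose g hg hRg using fun i => (hk i).exists_strongEmb (hL i)
  refine ⟨L, g, fun i => ⟨(hL i).2.2.1, hg i, ?_⟩⟩
  have hR : IsParam (b i) (R i) (k i ∘ g i) := ⟨hRg i, ((hk i).comp (hg i)).2⟩
  rw [hR.level_fan (hFR i) zero_le_one, hR.level_fan (hFR i) le_rfl]
  exact ⟨hFR i, hR.level_zero, hR.level_one⟩

/-- The letters coding one step of all the branches of a vector fan: one direction for every
immediate successor of every root. -/
abbrev FanAlphabet {d : ℕ} (b : Fin d → ℕ) : Type := (i : Fin d) → Fin (b i) → Fin (b i)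

section Coding

variable {d : ℕ} {b : Fin d → ℕ}

/-- The branch above the `p`-th immediate successor of the `i`-th root coded by the word `c`. -/
def track (i : Fin d) (p : Fin (b i)) (c : List (FanAlphabet b)) : List ℕ :=
  c.map fun a => (a i p : ℕ)

theorem track_mem_bSeq (i : Fin d) (p : Fin (b i)) (c : List (FanAlphabet b)) :
    track i p c ∈ bSeq (b i) := by
  intro x hx
  obtain ⟨a, -, rfl⟩ := List.mem_map.1 hx
  exact (a i p).2

theorem cons_track_mem_bSeq (i : Fin d) (p : Fin (b i)) (c : List (FanAlphabet b)) :
    (p : ℕ) :: track i p c ∈ bSeq (b i) :=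
  List.forall_mem_cons.2 ⟨p.2, track_mem_bSeq i p c⟩

theorem length_track (i : Fin d) (p : Fin (b i)) (c : List (FanAlphabet b)) :
    (track i p c).length = c.length := List.length_map _

theorem exists_track {m : ℕ} (τ : (i : Fin d) → Fin (b i) → List ℕ)
    (hτ : ∀ i p, τ i p ∈ bSeq (b i)) (hlen : ∀ i p, (τ i p).length = m) :
    ∃ σ : List (FanAlphabet b), σ.length = m ∧ ∀ i p, track i p σ = τ i p := by
  refine ⟨List.ofFn fun (j : Fin m) i p =>
    ⟨(τ i p)[j]'(by rw [hlen]; exact j.2), hτ i p _ (List.getElem_mem _)⟩, by simp, fun i p => ?_⟩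
  refine List.ext_getElem (by simp [track, hlen]) fun j h1 h2 => ?_
  simp [track]

theorem exists_track_eq (i : Fin d) (p : Fin (b i)) {τ : List ℕ} (hτ : τ ∈ bSeq (b i)) :
    ∃ σ : List (FanAlphabet b), σ.length = τ.length ∧ track i p σ = τ := by
  obtain ⟨σ, h1, h2⟩ := exists_track (b := b) (m := τ.length)
    (fun i' _ => if i' = i then τ else List.replicate τ.length 0)
    (by
      intro i' p'
      by_cases h : i' = i
      · subst h
        simpa using hτ
      · intro x hx
        rw [if_neg h] at hx
        rw [List.eq_of_mem_replicate hx]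
        exact p'.pos)
    (by
      intro i' p'
      split_ifs <;> simp)
  exact ⟨σ, h1, by simpa using h2 i p⟩

/-- The map of `b^{<ℕ}` induced in the `i`-th coordinate by a sequence of left variable words. -/
def spanEmb (i : Fin d) (s : List (FanAlphabet b)) (y : ℕ → List (Option (FanAlphabet b))) :
    List ℕ → List ℕ
  | [] => []
  | p :: τ => if h : p < b i then
      p :: (track i ⟨p, h⟩ s ++ (τ.mapIdx fun j a =>
        a :: (y j).map fun o => o.elim a fun z => (z i ⟨p, h⟩ : ℕ)).flatten)
    else []

/-- The level function of `spanEmb`. -/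
def spanLevel (s : List (FanAlphabet b)) (y : ℕ → List (Option (FanAlphabet b))) : ℕ → ℕ
  | 0 => 0
  | n + 1 => s.length + ∑ j ∈ Finset.range n, ((y j).length + 1) + 1

theorem strictMono_spanLevel (s : List (FanAlphabet b))
    (y : ℕ → List (Option (FanAlphabet b))) : StrictMono (spanLevel s y) := by
  refine strictMono_nat_of_lt_succ fun n => ?_
  cases n with
  | zero => simp [spanLevel]
  | succ n =>
    simp only [spanLevel, Finset.sum_range_succ]
    omega

theorem length_spanWord (s : List (FanAlphabet b)) (y : ℕ → List (Option (FanAlphabet b)))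
    (σ : List (FanAlphabet b)) : (spanWord s y σ).length + 1 = spanLevel s y (σ.length + 1) := by
  induction σ using List.reverseRecOn with
  | nil => simp [spanWord, spanLevel]
  | append_singleton σ a ih =>
    simp only [spanLevel, spanWord_concat, block, List.length_append, List.length_cons,
      List.length_map, List.length_nil, zero_add, Finset.sum_range_succ] at ih ⊢
    omega

theorem track_spanWord (i : Fin d) (p : Fin (b i)) (s : List (FanAlphabet b))
    (y : ℕ → List (Option (FanAlphabet b))) (σ : List (FanAlphabet b)) :
    track i p (spanWord s y σ) = track i p s ++ ((track i p σ).mapIdx fun j a =>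
      a :: (y j).map fun o => o.elim a fun z => (z i p : ℕ)).flatten := by
  induction σ using List.reverseRecOn with
  | nil => simp [spanWord, track]
  | append_singleton σ a ih =>
    have happ : ∀ c c' : List (FanAlphabet b),
        track i p (c ++ c') = track i p c ++ track i p c' := fun c c' => List.map_append
    have hblock : track i p (block a (y σ.length)) = (a i p : ℕ) ::
        (y σ.length).map fun o => o.elim (a i p : ℕ) fun z => (z i p : ℕ) := by
      simp only [track, block, List.map_cons, List.map_map, List.cons.injEq, true_and]
      refine List.map_congr_left fun o _ => ?_
      cases o <;> rfl
    rw [spanWord_concat, happ, ih, happ, hblock]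
    simp [track, List.mapIdx_concat]

theorem spanEmb_cons_track (i : Fin d) (p : Fin (b i)) (s : List (FanAlphabet b))
    (y : ℕ → List (Option (FanAlphabet b))) (σ : List (FanAlphabet b)) :
    spanEmb i s y ((p : ℕ) :: track i p σ) = (p : ℕ) :: track i p (spanWord s y σ) := by
  simp only [spanEmb, track_spanWord, p.2, dif_pos]

theorem isStrongEmb_spanEmb (i : Fin d) (s : List (FanAlphabet b))
    (y : ℕ → List (Option (FanAlphabet b))) :
    IsStrongEmb (b i) (spanLevel s y) (spanEmb i s y) where
  mapsTo := by
    rintro (_ | ⟨p, τ⟩) hτ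
    · exact nil_mem_bSeq _
    · obtain ⟨hp, hτ⟩ := List.forall_mem_cons.1 hτ
      obtain ⟨σ, -, rfl⟩ := exists_track_eq i ⟨p, hp⟩ hτ
      rw [spanEmb_cons_track i ⟨p, hp⟩ s y σ]
      exact cons_track_mem_bSeq i ⟨p, hp⟩ _
  length_eq := by
    rintro (_ | ⟨p, τ⟩) hτ
    · rfl
    · obtain ⟨hp, hτ⟩ := List.forall_mem_cons.1 hτ
      obtain ⟨σ, -, rfl⟩ := exists_track_eq i ⟨p, hp⟩ hτ
      rw [spanEmb_cons_track i ⟨p, hp⟩ s y σ, List.length_cons, List.length_cons, length_track,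
        length_track, length_spanWord]
  dir := by
    rintro (_ | ⟨p, τ⟩) hτ q hq
    · simp [spanEmb, hq]
    · obtain ⟨hp, -⟩ := List.forall_mem_cons.1 hτ
      simp only [spanEmb, List.cons_append, hp, dif_pos, List.mapIdx_concat, List.flatten_append,
        List.flatten_cons, List.flatten_nil]
      exact ⟨(y τ.length).map fun o => o.elim q fun z => (z i ⟨p, hp⟩ : ℕ), by
        simp only [List.append_assoc, List.cons_append, List.nil_append, List.append_nil]⟩

/-- The top of the vector fan coded by the word `c` with respect to the enumerations `f`. -/
def fanTop (f : Fin d → List ℕ → List ℕ) (c : List (FanAlphabet b)) : Set (Fin d → List ℕ) :=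
  {v | ∀ i, ∃ p : Fin (b i), v i = f i (p :: track i p c)}

theorem IsVecFan.exists_fanTop_eq {F : Fin d → Set (List ℕ)} {f : Fin d → List ℕ → List ℕ}
    {R : Fin d → Set (List ℕ)} {r : Fin d → List ℕ} (hf : ∀ i, IsParam (b i) (R i) (f i))
    (hr : ∀ i, r i = f i []) (s : List (FanAlphabet b))
    (y : ℕ → List (Option (FanAlphabet b)))
    (hF : IsVecFan (fun i => (f i ∘ spanEmb i s y) '' bSeq (b i)) F) (hFr : IsRoot F r)
    (i₀ : Fin d) (hb : ∀ i, 0 < b i) :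
    ∃ σ, vecLevel F 1 = fanTop f (spanWord s y σ) ∧
      ∀ n, vecLevel F 1 ⊆ vecLevel (fun i => (f i ∘ spanEmb i s y) '' bSeq (b i)) n →
        n = σ.length + 1 := by
  have hk := fun i => (hf i).comp (isStrongEmb_spanEmb i s y)
  obtain ⟨L, g, hg⟩ := hF.exists_strongEmb hk
  have hg0 : ∀ i, g i [] = [] := by
    intro i
    have h := (hg i).2.2.2.1
    rw [hFr i, Set.singleton_eq_singleton_iff, hr i] at h
    refine ((hk i).2.injOn (nil_mem_bSeq _) ((hg i).2.1.mapsTo (nil_mem_bSeq _)) ?_).symm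
    exact h
  have hp1 : ∀ i (p : Fin (b i)), [(p : ℕ)] ∈ bSeq (b i) := fun i p => by simp [bSeq]
  have hex : ∀ i (p : Fin (b i)), ∃ τ, g i [(p : ℕ)] = (p : ℕ) :: τ := by
    intro i p
    have h := (hg i).2.1.dir [] (nil_mem_bSeq _) p p.2
    rw [hg0 i] at h
    obtain ⟨τ, hτ⟩ := h
    exact ⟨τ, hτ.symm⟩
  choose τ hτ using hex
  have hL : L 1 = (L 1 - 1) + 1 := by
    have := (hg i₀).1 zero_lt_one
    omega
  obtain ⟨σ, hσlen, hσ⟩ := exists_track (b := b) (m := L 1 - 1) τ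
    (fun i p => by
      have h := (hg i).2.1.mapsTo (hp1 i p)
      rw [hτ] at h
      exact (List.forall_mem_cons.1 h).2)
    (fun i p => by
      have h := (hg i).2.1.length_eq _ (hp1 i p)
      rw [hτ, List.length_cons, List.length_singleton] at h
      omega)
  have htop : vecLevel F 1 = fanTop f (spanWord s y σ) := by
    ext v
    refine forall_congr' fun i => ?_
    rw [(hg i).2.2.2.2, Set.mem_ofPred_eq]
    constructor
    · rintro ⟨p, hp, h⟩
      refine ⟨⟨p, hp⟩, ?_⟩
      rw [h, hτ i ⟨p, hp⟩, ← hσ, Function.comp_apply, spanEmb_cons_track]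
    · rintro ⟨p, h⟩
      refine ⟨p, p.2, ?_⟩
      rw [h, hτ i p, ← hσ, Function.comp_apply, spanEmb_cons_track]
  refine ⟨σ, htop, fun n hn => ?_⟩
  have hmem : (fun i => f i (0 :: track i ⟨0, hb i⟩ (spanWord s y σ))) ∈ vecLevel F 1 :=
    htop ▸ fun i => ⟨⟨0, hb i⟩, rfl⟩
  have h := hn hmem i₀
  have heq := spanEmb_cons_track i₀ ⟨0, hb i₀⟩ s y σ
  have hlev := (hk i₀).apply_mem_level_iff (cons_track_mem_bSeq i₀ ⟨0, hb i₀⟩ σ) (n := n)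
  rw [Function.comp_apply, heq] at hlev
  rw [← hlev.1 h, List.length_cons, length_track]

theorem fanAt_ncard_pos {T : Fin d → Set (List ℕ)} {f : Fin d → List ℕ → List ℕ}
    (hf : ∀ i, IsParam (b i) (T i) (f i)) (hb : ∀ i, 0 < b i) (n : ℕ) :
    0 < (fanAt T (n + 1)).ncard := by
  have hfin : (fanAt T (n + 1)).Finite := by
    have hsub : fanAt T (n + 1) ⊆
        Set.pi Set.univ fun i => 𝒫 (⋃ m ∈ Set.Iic (n + 1), level (T i) m) := by
      rintro F ⟨hF, hFn⟩ i - t ht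
      obtain ⟨L, g, hg⟩ := hF.exists_strongEmb hf
      have hone : ∀ i, ∀ p < b i, [p] ∈ bSeq (b i) := fun i p hp => by simpa [bSeq] using hp
      have hmem : (fun i => f i (g i [0])) ∈ vecLevel F 1 := fun i => by
        rw [(hg i).2.2.2.2]
        exact ⟨0, hb i, rfl⟩
      have hL : L 1 = n + 1 := by
        have h := hFn hmem i
        rwa [(hf i).apply_mem_level_iff ((hg i).2.1.mapsTo (hone i 0 (hb i))),
          (hg i).2.1.length_eq _ (hone i 0 (hb i))] at h
      rw [(hg i).2.2.1, (hg i).2.2.2.1, (hg i).2.2.2.2] at ht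
      simp only [Set.mem_iUnion, Set.mem_Iic, exists_prop]
      obtain rfl | ⟨p, hp, rfl⟩ := ht
      · refine ⟨L 0, hL ▸ (hg i).1.monotone zero_le_one, ?_⟩
        exact ((hf i).apply_mem_level_iff ((hg i).2.1.mapsTo (nil_mem_bSeq _))).2
          ((hg i).2.1.length_eq _ (nil_mem_bSeq _))
      · refine ⟨L 1, hL.le, ?_⟩
        exact ((hf i).apply_mem_level_iff ((hg i).2.1.mapsTo (hone i p hp))).2
          ((hg i).2.1.length_eq _ (hone i p hp))
    refine Set.Finite.subset (Set.Finite.pi fun i => Set.Finite.finite_subsets ?_) hsub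
    exact (Set.finite_Iic _).biUnion fun m _ => (hf i).level_finite m
  refine (Set.ncard_pos hfin).2 ?_
  let s : List (FanAlphabet b) := List.replicate n fun i _ => ⟨0, hb i⟩
  let y : ℕ → List (Option (FanAlphabet b)) := fun _ => []
  let S : Fin d → Set (List ℕ) := fun i => (f i ∘ spanEmb i s y) '' bSeq (b i)
  have hS := fun i =>
    (hf i).isStrongSubtreeWith (isStrongEmb_spanEmb i s y) (strictMono_spanLevel s y)
  refine ⟨fun i => level (S i) 0 ∪ level (S i) 1, ⟨S, ⟨_, hS⟩, fun i => rfl⟩, fun v hv i => ?_⟩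
  have h := hv i
  rw [((hf i).comp (isStrongEmb_spanEmb i s y)).level_fan rfl le_rfl] at h
  have h' := (hS i).2.2.2.1 1 h
  simpa [spanLevel, s] using h'

end Coding

/-- Lemma 4.7: under hypothesis (H), inside every vector strong subtree `R`
one finds a vector strong subtree `S` with the same root and a single direction map `φ`
controlling all fans of `S` through the root. -/
theorem sparse_subtree_fixed_root (d : ℕ) (b : Fin d → ℕ) (T : Fin d → Set (List ℕ))
    (hT : IsVecHomogeneous b T)
    (bW : ℕ) (W : Set (List ℕ)) (hW : IsHomogeneous bW W)
    (ε : ℝ) (hε0 : 0 < ε) (hε1 : ε ≤ 1)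
    (l : ℕ → ℕ) (D : (Fin d → List ℕ) → Set (List ℕ)) (hD : IsDenseLevelSel T W l ε D)
    (hH : ∀ (R : Fin d → Set (List ℕ)) (r0 : Fin d → List ℕ) (w : List ℕ) (θ : ℝ),
      IsVecStrongSubtree T R → IsRoot R r0 → w ∈ W → 0 < θ → θ ≤ 1 →
        ¬ StronglyCorrelated T W bW l D R r0 w θ) :
    ∀ R : Fin d → Set (List ℕ), IsVecStrongSubtree T R →
      ∀ r0 : Fin d → List ℕ, IsRoot R r0 →
        ∃ S : Fin d → Set (List ℕ), IsVecStrongSubtree R S ∧ IsRoot S r0 ∧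
          ∃ φ : List ℕ → ℕ, (∀ w ∈ D r0, φ w < bW) ∧
            ∀ n, 1 ≤ n → ∀ F ∈ fanAt S n, IsRoot F r0 →
              ∀ w ∈ D r0, ∀ m, vecLevel F 1 ⊆ vecLevel T m →
                ∀ s, IsConcat W w (φ w) s →
                  densRel W (l m) (⋂ t ∈ vecLevel F 1, D t) s
                    ≤ ε / (2 * (bW : ℝ) * ((fanAt T n).ncard : ℝ)) := by
  rintro R ⟨lR, hR⟩ r0 hr0
  obtain ⟨k, hk⟩ := hW.exists_param
  obtain ⟨i₀⟩ : Nonempty (Fin d) := by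
    by_contra hd
    rw [not_nonempty_iff] at hd
    let v : Fin d → List ℕ := fun _ => []
    have h0 := hD.2 0 v fun i => hd.elim i
    have h1 := hD.2 1 v fun i => hd.elim i
    have hempty : D v = ∅ := Set.eq_empty_of_forall_notMem fun t ht =>
      (hD.1 zero_lt_one).ne (eq_of_mem_level (h0.1 ht) (h1.1 ht))
    have := h0.2
    simp only [hempty, dens, Set.ncard_empty, Nat.cast_zero, zero_div] at this
    linarith
  have hb : ∀ i, 0 < b i := fun i => zero_lt_two.trans_le (hT i).1
  have hbW : 0 < bW := zero_lt_two.trans_le hW.1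
  choose fT hfT using fun i => (hT i).exists_param
  choose gR hgR hRg using fun i => (hfT i).exists_strongEmb (hR i)
  let f : Fin d → List ℕ → List ℕ := fun i => fT i ∘ gR i
  have hf : ∀ i, IsParam (b i) (R i) (f i) := fun i => ⟨hRg i, ((hfT i).comp (hgR i)).2⟩
  have hr : ∀ i, r0 i = f i [] := fun i =>
    Set.singleton_eq_singleton_iff.1 ((hr0 i).symm.trans (hf i).level_zero)
  have hDr0 : D r0 ⊆ level W (l (lR 0)) :=
    (hD.2 (lR 0) r0 fun i => (hR i).2.2.2.1 0 (by rw [hr0 i]; rfl)).1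
  have : Finite (D r0) := ((hk.level_finite _).subset hDr0).to_subtype
  have : Nonempty (FanAlphabet b) := ⟨fun i p => p⟩
  have hlev : ∀ (c : List (FanAlphabet b)) (m : ℕ), fanTop f c ⊆ vecLevel T m →
      m = lR (c.length + 1) := by
    intro c m hm
    have h1 := hm (fun i => ⟨⟨0, hb i⟩, rfl⟩ :
      (fun i => f i (0 :: track i ⟨0, hb i⟩ c)) ∈ fanTop f c) i₀
    have h2 := (hR i₀).2.2.2.1 _ (((hf i₀).apply_mem_level_iff
      (cons_track_mem_bSeq i₀ ⟨0, hb i₀⟩ c)).2 rfl)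
    rw [eq_of_mem_level h1 h2, List.length_cons, length_track]
  let ρ : List (FanAlphabet b) → D r0 → Fin bW → ℝ := fun c w p =>
    densRel W (l (lR (c.length + 1))) (⋂ t ∈ fanTop f c, D t)
      (Classical.epsilon (IsConcat W w p))
  have hρeq : ∀ (c : List (FanAlphabet b)) (w : D r0) (p : Fin bW) (m : ℕ) (s : List ℕ),
      fanTop f c ⊆ vecLevel T m → IsConcat W w p s →
      densRel W (l m) (⋂ t ∈ fanTop f c, D t) s = ρ c w p := by
    intro c w p m s hm hs
    rw [hlev c m hm, hk.concat_unique hs (Classical.epsilon_spec ⟨s, hs⟩)]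
  have hroot : ∀ (s : List (FanAlphabet b)) (y : ℕ → List (Option (FanAlphabet b))),
      IsRoot (fun i => (f i ∘ spanEmb i s y) '' bSeq (b i)) r0 := by
    intro s y i
    rw [((hf i).comp (isStrongEmb_spanEmb i s y)).level_zero, hr i]
    rfl
  obtain ⟨s, y, φ, hφ⟩ := exists_span_decay ρ
    (by
      intro s y w θ hθ hall
      refine hH (fun i => (f i ∘ spanEmb i s y) '' bSeq (b i)) r0 w (min θ 1)
        ⟨lR ∘ spanLevel s y, fun i => (hfT i).isStrongSubtreeWith
          ((hgR i).comp (isStrongEmb_spanEmb i s y))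
          ((hR i).2.2.1.comp (strictMono_spanLevel s y))⟩
        (hroot s y) (hDr0 w.2).1 (lt_min hθ one_pos) (min_le_right _ _) ⟨w.2, ?_⟩
      intro F hF hFr m hm p hp t ht
      obtain ⟨σ, hσ, -⟩ := hF.exists_fanTop_eq hf hr s y hFr i₀ hb
      rw [hσ] at hm ⊢
      rw [hρeq _ w ⟨p, hp⟩ m t hm ht]
      exact (min_le_left _ _).trans (hall σ ⟨p, hp⟩))
    (fun n => ε / (2 * (bW : ℝ) * ((fanAt T (n + 1)).ncard : ℝ)))
    (fun n => by
      have := fanAt_ncard_pos hfT hb n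
      positivity)
  classical
  refine ⟨fun i => (f i ∘ spanEmb i s y) '' bSeq (b i),
    ⟨spanLevel s y, fun i => (hf i).isStrongSubtreeWith (isStrongEmb_spanEmb i s y)
      (strictMono_spanLevel s y)⟩, hroot s y,
    fun w => if h : w ∈ D r0 then φ ⟨w, h⟩ else 0, fun w hw => by simp [hw], ?_⟩
  rintro n - F ⟨hF, hFn⟩ hFr w hw m hm t ht
  simp only [dif_pos hw] at ht
  obtain ⟨σ, hσ, hσn⟩ := hF.exists_fanTop_eq hf hr s y hFr i₀ hb
  rw [hσn n hFn]
  rw [hσ] at hm ⊢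
  rw [hρeq _ ⟨w, hw⟩ (φ ⟨w, hw⟩) m t hm ht]
  exact (hφ σ ⟨w, hw⟩).le
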